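/- Let k ≥ 2, n ≥ 1, and let s, s' ∈ ℤ^n be tuples with gcd(s_i,k) = 1 and gcd(s'_i,k) = 1 for all i. If d_{Γ_{k,s}}(p,q) = d_{Γ_{k,s'}}(p,q) for all integers p, q with 0 ≤ p ≤ n(k−1) and 0 ≤ q ≤ n(k−1), then d_{Γ_{k,s}}(p,q) = d_{Γ_{k,s'}}(p,q) for all p, q ≥ 0 (so the generating functions F coincide and the CR lens spaces L(k;s) and L(k;s') are CR isospectral). -/

import Mathlib

open MvPolynomial Matrix Complex

noncomputable section

/-- The polynomial ring `ℂ[z_1,…,z_n, z̄_1,…,z̄_n]`. -/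
abbrev Rn (n : ℕ) := MvPolynomial (Fin n ⊕ Fin n) ℂ

/-- Weight assigning `(1,0)` to each `z_j` and `(0,1)` to each `z̄_j`. -/
def wt (n : ℕ) : (Fin n ⊕ Fin n) → ℕ × ℕ := Sum.elim (fun _ => (1, 0)) (fun _ => (0, 1))

/-- `𝒫_{p,q}`: polynomials homogeneous of degree `p` in `z` and `q` in `z̄`. -/
def Ppq (n p q : ℕ) : Submodule ℂ (Rn n) :=
  MvPolynomial.weightedHomogeneousSubmodule ℂ (wt n) (p, q)

/-- `Δ = Σ_j ∂²/∂z_j∂z̄_j`. -/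
def DeltaOp (n : ℕ) : Rn n →ₗ[ℂ] Rn n :=
  ∑ j : Fin n, (MvPolynomial.pderiv (Sum.inl j)).toLinearMap ∘ₗ (MvPolynomial.pderiv (Sum.inr j)).toLinearMap

/-- `ℋ_{p,q}`: harmonic polynomials of bidegree `(p,q)`. -/
def Hpq (n p q : ℕ) : Submodule ℂ (Rn n) :=
  Ppq n p q ⊓ LinearMap.ker (DeltaOp n)

/-- The action of a matrix `γ` on `R_n` by the algebra substitution
`z_i ↦ Σ_j (γ⁻¹)_{ij} z_j`, `z̄_i ↦ Σ_j conj((γ⁻¹)_{ij}) z̄_j`. -/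
def matAct (n : ℕ) (γ : Matrix (Fin n) (Fin n) ℂ) : Rn n →ₐ[ℂ] Rn n :=
  MvPolynomial.aeval (Sum.elim
    (fun i => ∑ j, (γ⁻¹ i j) • MvPolynomial.X (Sum.inl j))
    (fun i => ∑ j, (starRingEnd ℂ) (γ⁻¹ i j) • MvPolynomial.X (Sum.inr j)))

/-- The subspace of polynomials fixed by the action of `γ`. -/
def fixedBy (n : ℕ) (γ : Matrix (Fin n) (Fin n) ℂ) : Submodule ℂ (Rn n) :=
  LinearMap.ker ((matAct n γ).toLinearMap - LinearMap.id)

/-- `ℋ_{p,q}^Γ`, the `Γ`-invariant harmonic polynomials of bidegree `(p,q)`. -/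
def HpqInv (n p q : ℕ) (Γ : Subgroup (Matrix.unitaryGroup (Fin n) ℂ)) : Submodule ℂ (Rn n) :=
  Hpq n p q ⊓ ⨅ γ ∈ Γ, fixedBy n ↑γ

/-- `d_Γ(p,q) = dim_ℂ ℋ_{p,q}^Γ`. -/
def dInv (n p q : ℕ) (Γ : Subgroup (Matrix.unitaryGroup (Fin n) ℂ)) : ℕ :=
  Module.finrank ℂ (HpqInv n p q Γ)

/-- A subgroup of `U(n)` acts freely on `S^{2n-1}` iff no nontrivial element has `1` as an
eigenvalue. -/
def actsFreely (n : ℕ) (Γ : Subgroup (Matrix.unitaryGroup (Fin n) ℂ)) : Prop :=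
  ∀ γ ∈ Γ, γ ≠ 1 → ∀ v : Fin n → ℂ, (↑γ : Matrix (Fin n) (Fin n) ℂ).mulVec v = v → v = 0
/-- The standard primitive `k`-th root of unity `ξ_k = exp(2πi/k)`. -/
def xi (k : ℕ) : ℂ := Complex.exp (2 * Real.pi * Complex.I / k)

lemma xi_ne_zero (k : ℕ) : xi k ≠ 0 := Complex.exp_ne_zero _

lemma star_xi (k : ℕ) : (starRingEnd ℂ) (xi k) = (xi k)⁻¹ := by
  rw [xi, ← Complex.exp_conj, ← Complex.exp_neg]
  congr 1
  rw [map_div₀, _root_.map_mul, _root_.map_mul, Complex.conj_I]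
  simp [Complex.conj_ofReal, map_ofNat]
  ring

/-- The generator `γ_{k,s} = diag(ξ_k^{s_1}, …, ξ_k^{s_n})` of a lens group. -/
def lensGen (n : ℕ) (k : ℕ) (s : Fin n → ℤ) : Matrix (Fin n) (Fin n) ℂ :=
  Matrix.diagonal fun i => xi k ^ (s i)

lemma lensGen_mem (n k : ℕ) (s : Fin n → ℤ) :
    lensGen n k s ∈ Matrix.unitaryGroup (Fin n) ℂ := by
  rw [Matrix.mem_unitaryGroup_iff]
  have hstar : star (lensGen n k s) = Matrix.diagonal fun i => star (xi k ^ (s i)) := by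
    rw [lensGen, Matrix.star_eq_conjTranspose, Matrix.diagonal_conjTranspose]
    rfl
  rw [hstar, lensGen, Matrix.diagonal_mul_diagonal]
  convert Matrix.diagonal_one
  rename_i i
  have : (starRingEnd ℂ) (xi k ^ (s i)) = (xi k ^ (s i))⁻¹ := by
    rw [map_zpow₀, star_xi, _root_.inv_zpow]
  rw [RCLike.star_def, this, mul_inv_cancel₀ (zpow_ne_zero _ (xi_ne_zero k))]

/-- The cyclic subgroup `Γ_{k,s}` of `U(n)` generated by `γ_{k,s}`. -/
def lensSubgroup (n k : ℕ) (s : Fin n → ℤ) : Subgroup (Matrix.unitaryGroup (Fin n) ℂ) :=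
  Subgroup.zpowers ⟨lensGen n k s, lensGen_mem n k s⟩

/-- Multiplication by `|z|² = Σ_j z_j z̄_j`. -/
def normSqMul (n : ℕ) : Rn n →ₗ[ℂ] Rn n :=
  LinearMap.mulLeft ℂ (∑ j : Fin n, X (Sum.inl j) * X (Sum.inr j))

lemma normSqMul_apply (n : ℕ) (Q : Rn n) :
    normSqMul n Q = ∑ j : Fin n, X (Sum.inl j) * X (Sum.inr j) * Q := by
  simp [normSqMul, Finset.sum_mul]

lemma DeltaOp_apply (n : ℕ) (Q : Rn n) :
    DeltaOp n Q = ∑ j : Fin n, pderiv (Sum.inl j) (pderiv (Sum.inr j) Q) := by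
  simp [DeltaOp]

lemma pderiv_pderiv_mul_X_mul_X (n : ℕ) (j l : Fin n) (Q : Rn n) :
    pderiv (Sum.inl j) (pderiv (Sum.inr j) (X (Sum.inl l) * X (Sum.inr l) * Q)) =
      X (Sum.inl l) * X (Sum.inr l) * pderiv (Sum.inl j) (pderiv (Sum.inr j) Q) +
        if l = j then Q + (X (Sum.inl j) * pderiv (Sum.inl j) Q +
          X (Sum.inr j) * pderiv (Sum.inr j) Q) else 0 := by
  by_cases h : l = j
  · subst h
    simp [pderiv_X]
    ring
  · simp [pderiv_X, h]

lemma DeltaOp_normSqMul {n d : ℕ} {Q : Rn n} (hQ : Q.IsHomogeneous d) :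
    DeltaOp n (normSqMul n Q) = normSqMul n (DeltaOp n Q) + (n + d : ℂ) • Q := by
  have euler := hQ.sum_X_mul_pderiv
  rw [Fintype.sum_sum_type, ← Finset.sum_add_distrib] at euler
  rw [DeltaOp_apply, normSqMul_apply, normSqMul_apply, DeltaOp_apply]
  simp only [map_sum, pderiv_pderiv_mul_X_mul_X, Finset.sum_add_distrib, Finset.sum_ite_eq',
    Finset.mem_univ, if_true, Finset.mul_sum] at euler ⊢
  rw [euler, Finset.sum_comm, add_smul]
  simp [← Nat.cast_smul_eq_nsmul ℂ]

lemma DeltaOp_isHomogeneous {n d : ℕ} {Q : Rn n} (hQ : Q.IsHomogeneous d) :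
    (DeltaOp n Q).IsHomogeneous (d - 1 - 1) := by
  rw [DeltaOp_apply]
  exact IsHomogeneous.sum _ _ _ fun j _ => hQ.pderiv.pderiv

lemma DeltaOp_eq_zero_of_isHomogeneous_zero {n : ℕ} {Q : Rn n} (hQ : Q.IsHomogeneous 0) :
    DeltaOp n Q = 0 := by
  rw [← totalDegree_zero_iff_isHomogeneous, totalDegree_eq_zero_iff_eq_C] at hQ
  rw [DeltaOp_apply, hQ]
  simp

lemma eq_zero_of_normSqMul_DeltaOp_add_smul {n : ℕ} (d : ℕ) :
    ∀ {Q : Rn n} {c : ℝ}, 0 < c → Q.IsHomogeneous d →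
      normSqMul n (DeltaOp n Q) + (c : ℂ) • Q = 0 → Q = 0 := by
  induction d using Nat.strong_induction_on with
  | _ d ih =>
    intro Q c hc hQ h
    have hc' : (c : ℂ) ≠ 0 := by exact_mod_cast hc.ne'
    suffices hD : DeltaOp n Q = 0 by
      rw [hD, map_zero, zero_add] at h
      exact (smul_eq_zero.1 h).resolve_left hc'
    rcases Nat.eq_zero_or_pos d with rfl | hd
    · exact DeltaOp_eq_zero_of_isHomogeneous_zero hQ
    · have hD := DeltaOp_isHomogeneous hQ
      refine ih (d - 1 - 1) (by omega) (c := n + (d - 1 - 1 : ℕ) + c) (by positivity) hD ?_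
      have := congrArg (DeltaOp n) h
      rw [map_add, DeltaOp_normSqMul hD, map_smul, map_zero] at this
      rw [← this]
      push_cast
      module

lemma eq_zero_of_DeltaOp_normSqMul {n d : ℕ} (hn : 1 ≤ n) {Q : Rn n} (hQ : Q.IsHomogeneous d)
    (h : DeltaOp n (normSqMul n Q) = 0) : Q = 0 := by
  rw [DeltaOp_normSqMul hQ] at h
  refine eq_zero_of_normSqMul_DeltaOp_add_smul d (c := n + d) (by positivity) hQ ?_
  rw [← h]
  push_cast
  rfl

/-- The weight `(1, 0, s_j)` on `z_j` and `(0, 1, -s_j)` on `z̄_j`. -/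
def lensWt (n k : ℕ) (s : Fin n → ℤ) : Fin n ⊕ Fin n → ℕ × ℕ × ZMod k :=
  Sum.elim (fun j => (1, 0, (s j : ZMod k))) (fun j => (0, 1, -(s j : ZMod k)))

/-- The polynomials of bidegree `(p, q)` all of whose monomials are `Γ_{k,s}`-invariant. -/
def lensPpq (n k : ℕ) (s : Fin n → ℤ) (p q : ℕ) : Submodule ℂ (Rn n) :=
  weightedHomogeneousSubmodule ℂ (lensWt n k s) (p, q, 0)

lemma weight_lensWt (n k : ℕ) (s : Fin n → ℤ) (d : Fin n ⊕ Fin n →₀ ℕ) :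
    Finsupp.weight (lensWt n k s) d =
      (∑ j, d (Sum.inl j), ∑ j, d (Sum.inr j),
        ((∑ j, s j * ((d (Sum.inl j) : ℤ) - d (Sum.inr j)) : ℤ) : ZMod k)) := by
  rw [Finsupp.weight_apply, Finsupp.sum_fintype _ _ (by simp), Fintype.sum_sum_type]
  simp only [lensWt, Sum.elim_inl, Sum.elim_inr, Prod.smul_mk, ← Finset.sum_add_distrib]
  ext
  · simp [Prod.fst_sum]
  · simp [Prod.fst_sum, Prod.snd_sum]
  · simp only [Prod.snd_sum, Prod.mk_add_mk]
    push_cast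
    exact Finset.sum_congr rfl fun j _ => by simp; ring

lemma weight_wt (n : ℕ) (d : Fin n ⊕ Fin n →₀ ℕ) :
    Finsupp.weight (wt n) d = (∑ j, d (Sum.inl j), ∑ j, d (Sum.inr j)) := by
  rw [Finsupp.weight_apply, Finsupp.sum_fintype _ _ (by simp), Fintype.sum_sum_type]
  simp [wt, Prod.ext_iff, Prod.fst_sum, Prod.snd_sum]

lemma isHomogeneous_of_mem_lensPpq {n k : ℕ} {s : Fin n → ℤ} {p q : ℕ} {Q : Rn n}
    (hQ : Q ∈ lensPpq n k s p q) : Q.IsHomogeneous (p + q) := by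
  intro d hd
  have := hQ hd
  rw [weight_lensWt] at this
  simp only [Prod.mk.injEq] at this
  rw [Finsupp.weight_apply, Finsupp.sum_fintype _ _ (by simp), Fintype.sum_sum_type]
  simp [this.1, this.2.1]

lemma normSqMul_mem_lensPpq {n k : ℕ} {s : Fin n → ℤ} {p q : ℕ} {Q : Rn n}
    (hQ : Q ∈ lensPpq n k s p q) : normSqMul n Q ∈ lensPpq n k s (p + 1) (q + 1) := by
  rw [normSqMul_apply]
  refine Submodule.sum_mem _ fun j _ => ?_
  have := ((isWeightedHomogeneous_X ℂ (lensWt n k s) (Sum.inl j)).mul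
    (isWeightedHomogeneous_X ℂ (lensWt n k s) (Sum.inr j))).mul hQ
  rw [lensPpq, mem_weightedHomogeneousSubmodule]
  convert this using 1
  simp [lensWt, add_comm]

lemma DeltaOp_mem_lensPpq {n k : ℕ} {s : Fin n → ℤ} {p q : ℕ} {Q : Rn n}
    (hQ : Q ∈ lensPpq n k s (p + 1) (q + 1)) : DeltaOp n Q ∈ lensPpq n k s p q := by
  rw [DeltaOp_apply]
  refine Submodule.sum_mem _ fun j _ => ?_
  have hQ' : IsWeightedHomogeneous (lensWt n k s) Q (p + 1, q + 1, 0) := hQ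
  refine IsWeightedHomogeneous.pderiv (n := (p + 1, q, (s j : ZMod k)))
    (IsWeightedHomogeneous.pderiv hQ' ?_) ?_ <;> simp [lensWt]

/-- The Laplacian between spaces of invariant polynomials. -/
def lensDelta (n k : ℕ) (s : Fin n → ℤ) (p q : ℕ) :
    lensPpq n k s (p + 1) (q + 1) →ₗ[ℂ] lensPpq n k s p q :=
  (DeltaOp n).restrict fun _ hQ => DeltaOp_mem_lensPpq hQ

/-- The exponents of the `Γ_{k,s}`-invariant monomials of bidegree `(p, q)`. -/
def lensSet (n k : ℕ) (s : Fin n → ℤ) (p q : ℕ) : Set (Fin n ⊕ Fin n →₀ ℕ) :=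
  {d | Finsupp.weight (lensWt n k s) d = (p, q, 0)}

lemma mem_lensSet {n k : ℕ} {s : Fin n → ℤ} {p q : ℕ} {d : Fin n ⊕ Fin n →₀ ℕ} :
    d ∈ lensSet n k s p q ↔ ∑ j, d (Sum.inl j) = p ∧ ∑ j, d (Sum.inr j) = q ∧
      ((∑ j, s j * ((d (Sum.inl j) : ℤ) - d (Sum.inr j)) : ℤ) : ZMod k) = 0 := by
  rw [lensSet, Set.mem_ofPred_eq, weight_lensWt, Prod.mk.injEq, Prod.mk.injEq]

lemma finite_lensSet (n k : ℕ) (s : Fin n → ℤ) (p q : ℕ) :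
    (lensSet n k s p q).Finite := by
  refine (Finsupp.finite_of_degree_le (p + q)).subset fun d hd => ?_
  rw [mem_lensSet] at hd
  simp [Finsupp.degree_eq_sum, hd.1, hd.2.1]

instance (n k : ℕ) (s : Fin n → ℤ) (p q : ℕ) : Module.Finite ℂ (lensPpq n k s p q) := by
  have := (finite_lensSet n k s p q).to_subtype
  rw [lensPpq, weightedHomogeneousSubmodule_eq_finsupp_supported]
  exact Module.Finite.of_basis (basisRestrictSupport ℂ (lensSet n k s p q))

lemma finrank_lensPpq (n k : ℕ) (s : Fin n → ℤ) (p q : ℕ) :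
    Module.finrank ℂ (lensPpq n k s p q) =
      (lensSet n k s p q).ncard := by
  rw [lensPpq, weightedHomogeneousSubmodule_eq_finsupp_supported]
  exact Module.finrank_eq_nat_card_basis (basisRestrictSupport ℂ _)

lemma lensDelta_surjective {n : ℕ} (hn : 1 ≤ n) (k : ℕ) (s : Fin n → ℤ) (p q : ℕ) :
    Function.Surjective (lensDelta n k s p q) := by
  let E : lensPpq n k s p q →ₗ[ℂ] lensPpq n k s (p + 1) (q + 1) :=
    (normSqMul n).restrict fun _ hQ => normSqMul_mem_lensPpq hQ
  have hinj : Function.Injective (lensDelta n k s p q ∘ₗ E) := by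
    rw [injective_iff_map_eq_zero]
    intro Q hQ
    exact Subtype.ext <| eq_zero_of_DeltaOp_normSqMul hn (isHomogeneous_of_mem_lensPpq Q.2)
      (congrArg Subtype.val hQ)
  exact .of_comp (g := E) (LinearMap.injective_iff_surjective.1 hinj)

lemma finrank_lensPpq_inf_ker_succ {n : ℕ} (hn : 1 ≤ n) (k : ℕ) (s : Fin n → ℤ) (p q : ℕ) :
    Module.finrank ℂ ↥(lensPpq n k s (p + 1) (q + 1) ⊓ LinearMap.ker (DeltaOp n)) +
        Module.finrank ℂ (lensPpq n k s p q) =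
      Module.finrank ℂ (lensPpq n k s (p + 1) (q + 1)) := by
  rw [← (lensDelta n k s p q).finrank_range_add_finrank_ker,
    LinearMap.range_eq_top.2 (lensDelta_surjective hn k s p q), finrank_top, add_comm]
  congr 1
  rw [lensDelta, LinearMap.ker_restrict, ← Submodule.map_comap_subtype]
  exact (LinearEquiv.finrank_eq (Submodule.equivSubtypeMap _ _)).symm

lemma lensPpq_le_ker {n k : ℕ} {s : Fin n → ℤ} {p q : ℕ} (h : p = 0 ∨ q = 0) :
    lensPpq n k s p q ≤ LinearMap.ker (DeltaOp n) := by
  intro Q hQ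
  rw [LinearMap.mem_ker, Q.as_sum, map_sum]
  refine Finset.sum_eq_zero fun d hd => ?_
  have hd' := hQ (mem_support_iff.1 hd)
  rw [weight_lensWt] at hd'
  simp only [Prod.mk.injEq] at hd'
  rw [DeltaOp_apply]
  refine Finset.sum_eq_zero fun j _ => ?_
  rcases h with rfl | rfl
  · have : d (Sum.inl j) = 0 := by simpa using Finset.sum_eq_zero_iff.1 hd'.1 j
    simp [pderiv_monomial, this]
  · have : d (Sum.inr j) = 0 := by simpa using Finset.sum_eq_zero_iff.1 hd'.2.1 j
    simp [pderiv_monomial, this]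

lemma coeff_aeval_smul_X {σ R : Type*} [CommSemiring R] (c : σ → R) (P : MvPolynomial σ R)
    (d : σ →₀ ℕ) :
    coeff d (aeval (fun i => c i • (X i : MvPolynomial σ R)) P) =
      (d.prod fun i e => c i ^ e) * coeff d P := by
  classical
  induction P using MvPolynomial.induction_on' with
  | monomial u a =>
    have : aeval (fun i => c i • (X i : MvPolynomial σ R)) (monomial u a) =
        monomial u ((u.prod fun i e => c i ^ e) * a) := by
      rw [aeval_monomial, monomial_eq (a := _ * a)]
      simp only [smul_eq_C_mul, mul_pow, Finsupp.prod, Finset.prod_mul_distrib, map_mul, map_prod,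
        C_pow, algebraMap_eq]
      ring
    rw [this, coeff_monomial, coeff_monomial]
    split_ifs with h
    · rw [h]
    · simp
  | add P Q hP hQ => rw [map_add, coeff_add, hP, hQ, coeff_add, mul_add]

lemma lensGen_inv (n k : ℕ) (s : Fin n → ℤ) : (lensGen n k s)⁻¹ = lensGen n k (-s) := by
  refine Matrix.inv_eq_right_inv ?_
  rw [lensGen, lensGen, Matrix.diagonal_mul_diagonal, ← Matrix.diagonal_one]
  congr 1
  ext i
  simp [mul_inv_cancel₀ (zpow_ne_zero (s i) (xi_ne_zero k))]

lemma matAct_lensGen (n k : ℕ) (s : Fin n → ℤ) :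
    matAct n (lensGen n k s) = aeval (fun i =>
      (Sum.elim (fun j => xi k ^ (-s j)) (fun j => xi k ^ s j) i : ℂ) • X i) := by
  refine algHom_ext fun i => ?_
  rcases i with i | i
  · rw [matAct, lensGen_inv]
    simp [lensGen, Matrix.diagonal_apply, ite_smul]
  · rw [matAct, lensGen_inv]
    simp [lensGen, Matrix.diagonal_apply, apply_ite (starRingEnd ℂ), ite_smul, star_xi]

lemma coeff_matAct_lensGen (n k : ℕ) (s : Fin n → ℤ) (P : Rn n) (d : Fin n ⊕ Fin n →₀ ℕ) :
    coeff d (matAct n (lensGen n k s) P) =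
      xi k ^ (-∑ j, s j * ((d (Sum.inl j) : ℤ) - d (Sum.inr j))) * coeff d P := by
  have zpow_sum (t : Finset (Fin n)) (f : Fin n → ℤ) :
      xi k ^ (∑ j ∈ t, f j) = ∏ j ∈ t, xi k ^ f j := by
    induction t using Finset.cons_induction with
    | empty => simp
    | cons a t ha ih => rw [Finset.sum_cons, Finset.prod_cons, zpow_add₀ (xi_ne_zero k), ih]
  rw [matAct_lensGen, coeff_aeval_smul_X, Finsupp.prod_fintype _ _ (by simp), Fintype.prod_sum_type,
    ← Finset.sum_neg_distrib, zpow_sum, ← Finset.prod_mul_distrib]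
  congr 1
  refine Finset.prod_congr rfl fun j _ => ?_
  simp only [Sum.elim_inl, Sum.elim_inr]
  rw [← zpow_natCast, ← zpow_natCast, ← _root_.zpow_mul, ← _root_.zpow_mul, ← zpow_add₀ (xi_ne_zero k)]
  ring_nf

lemma mem_fixedBy_lensGen {n k : ℕ} (hk : k ≠ 0) (s : Fin n → ℤ) (P : Rn n) :
    P ∈ fixedBy n (lensGen n k s) ↔ ∀ d, coeff d P ≠ 0 →
      ((∑ j, s j * ((d (Sum.inl j) : ℤ) - d (Sum.inr j)) : ℤ) : ZMod k) = 0 := by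
  have hxi : IsPrimitiveRoot (xi k) k := Complex.isPrimitiveRoot_exp k hk
  rw [fixedBy, LinearMap.mem_ker, LinearMap.sub_apply, sub_eq_zero, MvPolynomial.ext_iff]
  refine forall_congr' fun d => ?_
  rw [AlgHom.toLinearMap_apply, coeff_matAct_lensGen, LinearMap.id_apply,
    ZMod.intCast_zmod_eq_zero_iff_dvd, ← dvd_neg, ← hxi.zpow_eq_one_iff_dvd, mul_left_eq_self₀]
  tauto

/-- The one-parameter subgroup `j ↦ γ_{k,s}^j`. -/
def lensHom (n k : ℕ) (s : Fin n → ℤ) : Multiplicative ℤ →* Matrix.unitaryGroup (Fin n) ℂ where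
  toFun j := ⟨lensGen n k (j.toAdd • s), lensGen_mem n k _⟩
  map_one' := by ext; simp [lensGen, Matrix.one_apply, Matrix.diagonal_apply]
  map_mul' a b := by
    ext
    simp [lensGen, Matrix.diagonal_mul_diagonal, add_mul, zpow_add₀ (xi_ne_zero k)]

lemma coe_mem_lensSubgroup {n k : ℕ} {s : Fin n → ℤ} {γ : Matrix.unitaryGroup (Fin n) ℂ}
    (hγ : γ ∈ lensSubgroup n k s) : ∃ j : ℤ, (γ : Matrix _ _ ℂ) = lensGen n k (j • s) := by
  obtain ⟨j, rfl⟩ := Subgroup.mem_zpowers_iff.1 hγ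
  have h1 : (⟨lensGen n k s, lensGen_mem n k s⟩ : Matrix.unitaryGroup (Fin n) ℂ) =
      lensHom n k s (Multiplicative.ofAdd 1) := by
    simp [lensHom]
  refine ⟨j, ?_⟩
  rw [h1, ← map_zpow, ← ofAdd_zsmul]
  simp [lensHom]

lemma HpqInv_lensSubgroup {n k : ℕ} (hk : k ≠ 0) (s : Fin n → ℤ) (p q : ℕ) :
    HpqInv n p q (lensSubgroup n k s) = lensPpq n k s p q ⊓ LinearMap.ker (DeltaOp n) := by
  rw [HpqInv, Hpq, inf_right_comm]
  congr 1
  ext P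
  simp only [Submodule.mem_inf, Submodule.mem_iInf]
  have hP : P ∈ Ppq n p q ↔ ∀ d, coeff d P ≠ 0 →
      ∑ j, d (Sum.inl j) = p ∧ ∑ j, d (Sum.inr j) = q := by
    refine forall_congr' fun d => ?_
    rw [weight_wt, Prod.mk.injEq]
  have hP' : P ∈ lensPpq n k s p q ↔ ∀ d, coeff d P ≠ 0 → d ∈ lensSet n k s p q := Iff.rfl
  rw [hP, hP']
  simp only [mem_lensSet]
  constructor
  · rintro ⟨h1, h2⟩ d hd
    have := (mem_fixedBy_lensGen hk s P).1
      (h2 ⟨lensGen n k s, lensGen_mem n k s⟩ (Subgroup.mem_zpowers _)) d hd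
    exact ⟨(h1 d hd).1, (h1 d hd).2, this⟩
  · refine fun h => ⟨fun d hd => ⟨(h d hd).1, (h d hd).2.1⟩, fun γ hγ => ?_⟩
    obtain ⟨j, hj⟩ := coe_mem_lensSubgroup hγ
    rw [hj, mem_fixedBy_lensGen hk]
    intro d hd
    have := (h d hd).2.2
    simp only [Pi.smul_apply, smul_eq_mul, mul_assoc, ← Finset.mul_sum]
    rw [Int.cast_mul, this, mul_zero]

lemma dInv_lensSubgroup_succ {n k : ℕ} (hn : 1 ≤ n) (hk : k ≠ 0) (s : Fin n → ℤ) (p q : ℕ) :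
    dInv n (p + 1) (q + 1) (lensSubgroup n k s) + (lensSet n k s p q).ncard =
      (lensSet n k s (p + 1) (q + 1)).ncard := by
  rw [dInv, HpqInv_lensSubgroup hk, ← finrank_lensPpq, ← finrank_lensPpq,
    finrank_lensPpq_inf_ker_succ hn]

lemma dInv_lensSubgroup_of_eq_zero {n k : ℕ} (hk : k ≠ 0) (s : Fin n → ℤ) {p q : ℕ}
    (h : p = 0 ∨ q = 0) :
    dInv n p q (lensSubgroup n k s) = (lensSet n k s p q).ncard := by
  rw [dInv, HpqInv_lensSubgroup hk, inf_eq_left.2 (lensPpq_le_ker h), finrank_lensPpq]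

lemma forall_ncard_lensSet_eq {n k : ℕ} (hn : 1 ≤ n) (hk : k ≠ 0) {s s' : Fin n → ℤ} {M : ℕ}
    (h : ∀ p q : ℕ, p ≤ M → q ≤ M →
      dInv n p q (lensSubgroup n k s) = dInv n p q (lensSubgroup n k s')) (p : ℕ) :
    ∀ q, p ≤ M → q ≤ M → (lensSet n k s p q).ncard = (lensSet n k s' p q).ncard := by
  induction p with
  | zero =>
    intro q hp hq
    rw [← dInv_lensSubgroup_of_eq_zero hk s (.inl rfl),
      ← dInv_lensSubgroup_of_eq_zero hk s' (.inl rfl), h 0 q hp hq]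
  | succ p ih =>
    rintro (_ | q) hp hq
    · rw [← dInv_lensSubgroup_of_eq_zero hk s (.inr rfl),
        ← dInv_lensSubgroup_of_eq_zero hk s' (.inr rfl), h _ 0 hp hq]
    · rw [← dInv_lensSubgroup_succ hn hk, ← dInv_lensSubgroup_succ hn hk, h _ _ hp hq,
        ih q (by omega) (by omega)]

/-- The exponents in `lensSet` all of whose entries are less than `k`. -/
def reducedLensSet (n k : ℕ) (s : Fin n → ℤ) (p q : ℕ) : Set (Fin n ⊕ Fin n →₀ ℕ) :=
  {d ∈ lensSet n k s p q | ∀ i, d i < k}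

lemma reducedLensSet_eq_empty {n k : ℕ} (s : Fin n → ℤ) {p q : ℕ}
    (h : n * (k - 1) < p ∨ n * (k - 1) < q) : reducedLensSet n k s p q = ∅ := by
  refine Set.eq_empty_of_forall_notMem fun d ⟨hd, hlt⟩ => ?_
  rw [mem_lensSet] at hd
  have bound (f : Fin n → Fin n ⊕ Fin n) : ∑ j, d (f j) ≤ n * (k - 1) := by
    simpa using Finset.sum_le_card_nsmul Finset.univ (fun j => d (f j)) (k - 1)
      fun j _ => Nat.le_sub_one_of_lt (hlt _)
  have := bound Sum.inl
  have := bound Sum.inr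
  omega

lemma add_smul_mem_lensSet {n k : ℕ} (s : Fin n → ℤ) (p q : ℕ) (r t : Fin n ⊕ Fin n →₀ ℕ) :
    r + k • t ∈ lensSet n k s p q ↔
      k * ∑ j, t (Sum.inl j) ≤ p ∧ k * ∑ j, t (Sum.inr j) ≤ q ∧
      r ∈ lensSet n k s (p - k * ∑ j, t (Sum.inl j)) (q - k * ∑ j, t (Sum.inr j)) := by
  have hz : ((∑ j, s j * (((r + k • t) (Sum.inl j) : ℤ) - (r + k • t) (Sum.inr j)) : ℤ) : ZMod k) =
      ((∑ j, s j * ((r (Sum.inl j) : ℤ) - r (Sum.inr j)) : ℤ) : ZMod k) := by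
    simp
  rw [mem_lensSet, mem_lensSet, hz]
  simp only [Finsupp.add_apply, Finsupp.smul_apply, smul_eq_mul, Finset.sum_add_distrib,
    ← Finset.mul_sum]
  constructor
  · rintro ⟨h1, h2, h3⟩
    exact ⟨by omega, by omega, by omega, by omega, h3⟩
  · rintro ⟨h1, h2, h3, h4, h5⟩
    exact ⟨by omega, by omega, h5⟩

lemma ncard_lensSet_fiber {n k : ℕ} (hk : 0 < k) (s : Fin n → ℤ) (p q : ℕ)
    (t : Fin n ⊕ Fin n →₀ ℕ) :
    {d ∈ lensSet n k s p q | d.mapRange (· / k) (Nat.zero_div k) = t}.ncard =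
      if k * ∑ j, t (Sum.inl j) ≤ p ∧ k * ∑ j, t (Sum.inr j) ≤ q then
        (reducedLensSet n k s (p - k * ∑ j, t (Sum.inl j)) (q - k * ∑ j, t (Sum.inr j))).ncard
      else 0 := by
  have decomp (d : Fin n ⊕ Fin n →₀ ℕ) :
      d.mapRange (· % k) (Nat.zero_mod k) + k • d.mapRange (· / k) (Nat.zero_div k) = d := by
    ext i
    simpa using Nat.mod_add_div (d i) k
  split_ifs with h
  · rw [← Set.ncard_image_of_injective (reducedLensSet n k s _ _) (add_left_injective (k • t))]
    congr 1
    ext d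
    constructor
    · rintro ⟨hd, rfl⟩
      rw [← decomp d, add_smul_mem_lensSet] at hd
      exact ⟨_, ⟨hd.2.2, fun i => by simpa using Nat.mod_lt _ hk⟩, decomp d⟩
    · rintro ⟨r, ⟨hr, hlt⟩, rfl⟩
      refine ⟨(add_smul_mem_lensSet s p q r t).2 ⟨h.1, h.2, hr⟩, ?_⟩
      ext i
      simp [Nat.add_mul_div_left _ _ hk, Nat.div_eq_of_lt (hlt i)]
  · convert Set.ncard_empty (Fin n ⊕ Fin n →₀ ℕ)
    refine Set.eq_empty_of_forall_notMem ?_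
    rintro d ⟨hd, rfl⟩
    rw [← decomp d, add_smul_mem_lensSet] at hd
    exact h ⟨hd.1, hd.2.1⟩

lemma ncard_lensSet {n k : ℕ} (hk : 0 < k) (s : Fin n → ℤ) (p q : ℕ) :
    (lensSet n k s p q).ncard =
      ∑ t ∈ (Finsupp.finite_of_degree_le (σ := Fin n ⊕ Fin n) (p + q)).toFinset,
        if k * ∑ j, t (Sum.inl j) ≤ p ∧ k * ∑ j, t (Sum.inr j) ≤ q then
          (reducedLensSet n k s (p - k * ∑ j, t (Sum.inl j)) (q - k * ∑ j, t (Sum.inr j))).ncard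
        else 0 := by
  classical
  have hfin := finite_lensSet n k s p q
  rw [Set.ncard_eq_toFinset_card _ hfin, Finset.card_eq_sum_card_fiberwise
    (f := fun d => d.mapRange (· / k) (Nat.zero_div k))
    (t := (Finsupp.finite_of_degree_le (σ := Fin n ⊕ Fin n) (p + q)).toFinset)]
  · refine Finset.sum_congr rfl fun t _ => ?_
    rw [← ncard_lensSet_fiber hk, ← Set.ncard_coe_finset]
    congr 1
    ext d
    simp
  · intro d hd
    simp only [Set.Finite.coe_toFinset, mem_lensSet] at hd
    simp only [Set.Finite.coe_toFinset, Set.mem_ofPred_eq, Finsupp.degree_eq_sum,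
      Fintype.sum_sum_type, Finsupp.mapRange_apply]
    rw [← hd.1, ← hd.2.1]
    exact add_le_add (Finset.sum_le_sum fun _ _ => Nat.div_le_self _ _)
      (Finset.sum_le_sum fun _ _ => Nat.div_le_self _ _)

lemma ncard_reducedLensSet_eq {n k : ℕ} (hk : 0 < k) {s s' : Fin n → ℤ}
    (h : ∀ p q : ℕ, p ≤ n * (k - 1) → q ≤ n * (k - 1) →
      (lensSet n k s p q).ncard = (lensSet n k s' p q).ncard) (p q : ℕ) :
    (reducedLensSet n k s p q).ncard = (reducedLensSet n k s' p q).ncard := by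
  classical
  induction hm : p + q using Nat.strong_induction_on generalizing p q with
  | _ m ih =>
    by_cases hpq : p ≤ n * (k - 1) ∧ q ≤ n * (k - 1)
    · have key := h p q hpq.1 hpq.2
      have h0 : (0 : Fin n ⊕ Fin n →₀ ℕ) ∈
          (Finsupp.finite_of_degree_le (σ := Fin n ⊕ Fin n) (p + q)).toFinset := by simp
      rw [ncard_lensSet hk, ncard_lensSet hk, ← Finset.add_sum_erase _ _ h0,
        ← Finset.add_sum_erase _ _ h0] at key
      simp only [Finsupp.coe_zero, Pi.zero_apply, Finset.sum_const_zero, mul_zero, Nat.zero_le,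
        and_self, if_true, Nat.sub_zero] at key
      refine Nat.add_right_cancel (key.trans (congrArg _ (Finset.sum_congr rfl fun t ht => ?_).symm))
      split_ifs with hle
      · have ht0 : ∑ j, t (Sum.inl j) + ∑ j, t (Sum.inr j) ≠ 0 := by
          rw [← Fintype.sum_sum_type, ← Finsupp.degree_eq_sum, Ne, Finsupp.degree_eq_zero_iff]
          exact Finset.ne_of_mem_erase ht
        have := Nat.mul_pos hk (Nat.pos_of_ne_zero ht0)
        rw [mul_add] at this
        exact ih _ (by omega) _ _ rfl
      · rfl
    · rw [reducedLensSet_eq_empty s (by omega), reducedLensSet_eq_empty s' (by omega)]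

/-- **Finiteness condition for CR isospectrality of lens spaces.**
If the invariant dimensions `d_Γ(p,q)` agree for all `0 ≤ p, q ≤ n(k-1)`, then they agree
for all `p, q ≥ 0`, so the generating functions coincide and the CR lens spaces
`L(k;s)` and `L(k;s')` are CR isospectral. -/
theorem finiteness_condition_CR_isospectral (k n : ℕ) (hk : 2 ≤ k) (hn : 1 ≤ n)
    (s s' : Fin n → ℤ)
    (hs : ∀ i, Int.gcd (s i) k = 1) (hs' : ∀ i, Int.gcd (s' i) k = 1)
    (h : ∀ p q : ℕ, p ≤ n * (k - 1) → q ≤ n * (k - 1) →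
      dInv n p q (lensSubgroup n k s) = dInv n p q (lensSubgroup n k s')) :
    ∀ p q : ℕ, dInv n p q (lensSubgroup n k s) = dInv n p q (lensSubgroup n k s') := by
  have hk0 : k ≠ 0 := by omega
  have hN : ∀ p q, (lensSet n k s p q).ncard = (lensSet n k s' p q).ncard := fun p q => by
    rw [ncard_lensSet (by omega), ncard_lensSet (by omega)]
    simp only [ncard_reducedLensSet_eq (by omega)
      fun p q hp hq => forall_ncard_lensSet_eq hn hk0 h p q hp hq]
  have hzero (p q : ℕ) (hpq : p = 0 ∨ q = 0) :
      dInv n p q (lensSubgroup n k s) = dInv n p q (lensSubgroup n k s') := by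
    rw [dInv_lensSubgroup_of_eq_zero hk0 s hpq, dInv_lensSubgroup_of_eq_zero hk0 s' hpq, hN]
  rintro (_ | p) q
  · exact hzero _ _ (.inl rfl)
  obtain _ | q := q
  · exact hzero _ _ (.inr rfl)
  refine Nat.add_right_cancel (m := (lensSet n k s p q).ncard) ?_
  rw [dInv_lensSubgroup_succ hn hk0, hN p q, dInv_lensSubgroup_succ hn hk0, hN]

end
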